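/- For each g ∈ B1 and k ∈ B2, ε_r(g,k) > 0. -/

import Mathlib

open Finset

noncomputable section

/-- Feasibility for system `S`. -/
def FeasibleS {J M : Type*} [Fintype J] [Fintype M]
    (G1 G2 : Finset M) (b : J → M → ℕ) (a1 a2 : J → ℕ)
    (y : J → M → ℝ) (x1 x2 : J → ℝ) (r w : ℝ) : Prop :=
  (∀ h ∈ G1, ((∑ j, (b j h : ℝ)) - ((∑ j, (a2 j : ℝ)) - r) ≤ (∑ j, y j h)) ∧
    ((∑ j, y j h) ≤ w)) ∧
  (∀ h ∈ G2, ((∑ j, (b j h : ℝ)) - ((∑ j, (a1 j : ℝ)) - r) ≤ (∑ j, y j h)) ∧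
    ((∑ j, y j h) ≤ w)) ∧
  (∀ j, (∑ h, y j h) ≤ w) ∧
  (∀ j, ∀ h, 0 ≤ y j h ∧ y j h ≤ (b j h : ℝ)) ∧
  ((∑ j, x1 j) = r) ∧ ((∑ j, x2 j) = r) ∧
  (∀ j, x1 j + x2 j ≤ r) ∧
  (∀ j, 0 ≤ x1 j ∧ x1 j ≤ (a1 j : ℝ)) ∧
  (∀ j, 0 ≤ x2 j ∧ x2 j ≤ (a2 j : ℝ)) ∧
  (∀ j, (∑ h ∈ G1, ((b j h : ℝ) - y j h)) + (a2 j : ℝ) - x2 j ≤ (∑ j', (a2 j' : ℝ)) - r) ∧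
  (∀ j, (∑ h ∈ G2, ((b j h : ℝ) - y j h)) + (a1 j : ℝ) - x1 j ≤ (∑ j', (a1 j' : ℝ)) - r)

/-- Feasibility for the linear program `ℓp` associated with an optimal
LP-relaxation value `(rstar, wstar)`. -/
def FeasibleLP {J M : Type*} [Fintype J] [Fintype M]
    (G1 G2 : Finset M) (b : J → M → ℕ) (a1 a2 : J → ℕ)
    (rstar wstar : ℝ)
    (y : J → M → ℝ) (x1 x2 : J → ℝ) (r w : ℝ) : Prop :=
  FeasibleS G1 G2 b a1 a2 y x1 x2 r w ∧
  w - r = (⌈wstar - rstar⌉ : ℝ) ∧ ((⌊rstar⌋ : ℝ) ≤ r)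

/-- The quantity `ε_r(g,k)`. -/
def epsR {J : Type*} [DecidableEq J] (B1 B2 : Finset J) (x1 x2 : J → ℝ)
    (r ε : ℝ) (g k : J) : ℝ :=
  if hne : ((B1 ∪ B2) \ {g, k}).Nonempty then
    min (((B1 ∪ B2) \ {g, k}).inf' hne (fun j => r - (x1 j + x2 j))) ε
  else ε

/-- The slack `ε_a(g)`. -/
def epsA {J M : Type*} [Fintype J] (G2 : Finset M) (b : J → M → ℕ) (a1 : J → ℕ)
    (y : J → M → ℝ) (x1 : J → ℝ) (r : ℝ) (g : J) : ℝ :=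
  (∑ h ∈ G2, y g h) -
    ((∑ h ∈ G2, (b g h : ℝ)) + (a1 g : ℝ) - x1 g - (∑ j, (a1 j : ℝ)) + r)

/-- The slack `ε_c(k)`. -/
def epsC {J M : Type*} [Fintype J] (G1 : Finset M) (b : J → M → ℕ) (a2 : J → ℕ)
    (y : J → M → ℝ) (x2 : J → ℝ) (r : ℝ) (k : J) : ℝ :=
  (∑ h ∈ G1, y k h) -
    ((∑ h ∈ G1, (b k h : ℝ)) + (a2 k : ℝ) - x2 k - (∑ j, (a2 j : ℝ)) + r)

/-- Birkhoff: an integral matching in the support of a column-stochastic, row-substochastic matrix. -/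
lemma exists_matching {J M : Type*} [Fintype J] [Fintype M] [DecidableEq J] [DecidableEq M]
    (Y : J → M → ℝ) (hY : ∀ i h, 0 ≤ Y i h) (hcol : ∀ h, ∑ i, Y i h = 1)
    (hrow : ∀ i, ∑ h, Y i h ≤ 1) (k : J) (G : Finset M) (hk : ∑ h ∈ G, Y k h < 1) :
    ∃ d : J → M → ℝ, (∀ i h, 0 ≤ d i h) ∧ (∀ i h, Y i h = 0 → d i h = 0) ∧
      (∀ h, ∑ i, d i h = 1) ∧ (∀ i, ∑ h, d i h ≤ 1) ∧
      (∀ i, ∑ h, Y i h = 1 → ∑ h, d i h = 1) ∧ (∀ h ∈ G, d k h = 0) ∧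
      (∀ (H : Finset M) i, (∀ h ∈ H, d i h = 0) ∨ (∀ h, h ∉ H → d i h = 0)) := by
  let S : Matrix (J ⊕ M) (J ⊕ M) ℝ := fun a c => match a, c with
    | .inl i, .inl i' => if i = i' then 1 - ∑ h, Y i h else 0
    | .inl i, .inr h => Y i h
    | .inr h, .inl i => Y i h
    | .inr _, .inr _ => 0
  have hS : S ∈ doublyStochastic ℝ (J ⊕ M) := by
    rw [mem_doublyStochastic_iff_sum]
    refine ⟨?_, ?_, ?_⟩
    · rintro (i | h) (i' | h')
      · by_cases hi : i = i'
        · simpa [S, hi] using hrow i'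
        · simp [S, hi]
      · exact hY _ _
      · exact hY _ _
      · exact le_refl _
    · rintro (i | h)
      · simp [S]
      · simp [S, hcol]
    · rintro (i | h)
      · simp [S]
      · simp [S, hcol]
  obtain ⟨wt, hwt0, hwt1, hwtS⟩ := exists_eq_sum_perm_of_mem_doublyStochastic hS
  have hent : ∀ a c, S a c = ∑ σ : Equiv.Perm (J ⊕ M), if σ a = c then wt σ else 0 := by
    intro a c
    rw [← hwtS, Matrix.sum_apply]
    refine Finset.sum_congr rfl fun σ _ => ?_
    simp [Matrix.smul_apply, Equiv.Perm.permMatrix, PEquiv.toMatrix_apply, eq_comm]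
  -- a permutation of positive weight avoiding `G` at `k`
  obtain ⟨σ, hσ, hσk⟩ : ∃ σ : Equiv.Perm (J ⊕ M), 0 < wt σ ∧ ∀ h ∈ G, σ (.inl k) ≠ .inr h := by
    by_contra hcon
    push Not at hcon
    have : ∑ h ∈ G, Y k h = 1 := by
      have h1 : ∀ h, Y k h = ∑ σ : Equiv.Perm (J ⊕ M), if σ (.inl k) = .inr h then wt σ else 0 :=
        fun h => hent (.inl k) (.inr h)
      rw [Finset.sum_congr rfl fun h _ => h1 h, Finset.sum_comm, ← hwt1]
      refine Finset.sum_congr rfl fun σ _ => ?_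
      rcases (hwt0 σ).lt_or_eq with hpos | hz
      · obtain ⟨h, hh, hs⟩ := hcon σ hpos
        simp [hs, hh]
      · simp [← hz]
    linarith
  have hpos : ∀ a, 0 < S a (σ a) := by
    intro a
    rw [hent]
    refine lt_of_lt_of_le hσ ?_
    have := Finset.single_le_sum (f := fun τ : Equiv.Perm (J ⊕ M) => if τ a = σ a then wt τ else 0)
      (fun τ _ => by split_ifs <;> simp [hwt0]) (Finset.mem_univ σ)
    simpa using this
  refine ⟨fun i h => if σ (.inl i) = .inr h then 1 else 0, ?_, ?_, ?_, ?_, ?_, ?_, ?_⟩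
  · intro i h; dsimp only; split_ifs <;> norm_num
  · intro i h h0
    dsimp only
    rw [if_neg]
    intro hs
    have := hpos (.inl i)
    rw [hs] at this
    exact absurd h0 (ne_of_gt this)
  · intro h
    rcases hc : σ.symm (.inr h) with i | h'
    · have : σ (.inl i) = .inr h := by rw [← hc]; simp
      rw [Finset.sum_eq_single i]
      · simp [this]
      · intro i' _ hne
        refine if_neg ?_
        intro h2
        exact hne (Sum.inl_injective (σ.injective (h2.trans this.symm)))
      · simp
    · have h2 : σ (.inr h') = .inr h := by rw [← hc]; simp
      have := hpos (.inr h')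
      rw [h2] at this
      exact absurd this (lt_irrefl _)
  · intro i
    rcases hc : σ (.inl i) with i' | h'
    · simp [hc]
    · simp [hc]
  · intro i h1
    rcases hc : σ (.inl i) with i' | h'
    · have := hpos (.inl i)
      rw [hc] at this
      by_cases hi : i = i'
      · subst hi
        simp [S, h1] at this
      · simp [S, hi] at this
    · simp [hc]
  · intro h hh
    simp [hσk h hh]
  · intro H i
    rcases hc : σ (.inl i) with i' | h'
    · left; intro h _; simp [hc]
    · by_cases hH : h' ∈ H
      · right; intro h hh
        have : h' ≠ h := fun e => hh (e ▸ hH)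
        simp [hc, this]
      · left; intro h hh
        have : h' ≠ h := fun e => hH (e ▸ hh)
        simp [hc, this]

/-- An affine inequality valid at `0`, nonincreasing when tight, stays valid for small steps. -/
lemma ev_aff (A B : ℝ) (hA : A ≤ 0) (hB : A = 0 → B ≤ 0) :
    ∀ᶠ δ in nhdsWithin (0 : ℝ) (Set.Ioi 0), A + δ * B ≤ 0 := by
  rcases hA.lt_or_eq with h | h
  · have hc : Filter.Tendsto (fun δ : ℝ => A + δ * B) (nhdsWithin (0 : ℝ) (Set.Ioi 0))
        (nhds (A + 0 * B)) :=
      ((continuous_const.add (continuous_id.mul continuous_const)).tendsto 0).mono_left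
        nhdsWithin_le_nhds
    have := hc.eventually (gt_mem_nhds (show A + 0 * B < 0 by simpa using h))
    exact this.mono fun _ hx => le_of_lt hx
  · filter_upwards [self_mem_nhdsWithin] with δ hδ
    have hδ' : (0 : ℝ) < δ := hδ
    rw [h, zero_add]
    exact mul_nonpos_of_nonneg_of_nonpos hδ'.le (hB h)

/-- Decreasing `r` and `w` along a direction compatible with all tight constraints. -/
lemma exists_step {J M : Type*} [Fintype J] [Fintype M]
    (G1 G2 : Finset M) (b : J → M → ℕ) (a1 a2 : J → ℕ)
    (y : J → M → ℝ) (x1 x2 : J → ℝ) (r w fl : ℝ)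
    (hf : FeasibleS G1 G2 b a1 a2 y x1 x2 r w) (hfl : fl < r)
    (hsat1 : ∀ h ∈ G1, ((∑ j, y j h) = w) ∧
      (w = (∑ j, (b j h : ℝ)) - ((∑ j, (a2 j : ℝ)) - r)))
    (hsat2 : ∀ h ∈ G2, ((∑ j, y j h) = w) ∧
      (w = (∑ j, (b j h : ℝ)) - ((∑ j, (a1 j : ℝ)) - r)))
    (d : J → M → ℝ) (e1 e2 : J → ℝ)
    (hd0 : ∀ i h, 0 ≤ d i h) (hdy : ∀ i h, y i h = 0 → d i h = 0)
    (hdc : ∀ h, ∑ i, d i h = 1) (hdr : ∀ i, ∑ h, y i h = w → ∑ h, d i h = 1)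
    (he1 : ∀ i, 0 ≤ e1 i) (he2 : ∀ i, 0 ≤ e2 i)
    (hx1 : ∀ i, x1 i = 0 → e1 i = 0) (hx2 : ∀ i, x2 i = 0 → e2 i = 0)
    (hs1 : ∑ i, e1 i = 1) (hs2 : ∑ i, e2 i = 1)
    (hX : ∀ i, x1 i + x2 i = r → 1 ≤ e1 i + e2 i)
    (hA : ∀ i, (∑ h ∈ G1, ((b i h : ℝ) - y i h)) + (a2 i : ℝ) - x2 i = (∑ j', (a2 j' : ℝ)) - r →
      ∑ h ∈ G1, d i h + e2 i ≤ 1)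
    (hC : ∀ i, (∑ h ∈ G2, ((b i h : ℝ) - y i h)) + (a1 i : ℝ) - x1 i = (∑ j', (a1 j' : ℝ)) - r →
      ∑ h ∈ G2, d i h + e1 i ≤ 1) :
    ∃ δ : ℝ, 0 < δ ∧ fl ≤ r - δ ∧ FeasibleS G1 G2 b a1 a2 (fun i h => y i h - δ * d i h)
      (fun i => x1 i - δ * e1 i) (fun i => x2 i - δ * e2 i) (r - δ) (w - δ) := by
  obtain ⟨-, -, f3, f4, f5, f6, f7, f8, f9, f10, f11⟩ := hf
  have E0 := ev_aff (fl - r) 1 (by linarith) (by intro h; linarith)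
  have E3 := Filter.eventually_all.2 fun i => ev_aff (∑ h, y i h - w) (1 - ∑ h, d i h)
    (by linarith [f3 i]) (by intro h; linarith [hdr i (by linarith)])
  have E4 := Filter.eventually_all.2 fun i => Filter.eventually_all.2 fun h =>
    ev_aff (- y i h) (d i h) (by linarith [(f4 i h).1])
      (by intro h'; exact (hdy i h (by linarith)).le)
  have E7 := Filter.eventually_all.2 fun i => ev_aff (x1 i + x2 i - r) (1 - e1 i - e2 i)
    (by linarith [f7 i]) (by intro h; linarith [hX i (by linarith)])
  have E8 := Filter.eventually_all.2 fun i => ev_aff (- x1 i) (e1 i)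
    (by linarith [(f8 i).1]) (by intro h; exact (hx1 i (by linarith)).le)
  have E9 := Filter.eventually_all.2 fun i => ev_aff (- x2 i) (e2 i)
    (by linarith [(f9 i).1]) (by intro h; exact (hx2 i (by linarith)).le)
  have E10 := Filter.eventually_all.2 fun i => ev_aff
    ((∑ h ∈ G1, ((b i h : ℝ) - y i h)) + (a2 i : ℝ) - x2 i - ((∑ j', (a2 j' : ℝ)) - r))
    (∑ h ∈ G1, d i h + e2 i - 1)
    (by linarith [f10 i]) (by intro h; linarith [hA i (by linarith)])
  have E11 := Filter.eventually_all.2 fun i => ev_aff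
    ((∑ h ∈ G2, ((b i h : ℝ) - y i h)) + (a1 i : ℝ) - x1 i - ((∑ j', (a1 j' : ℝ)) - r))
    (∑ h ∈ G2, d i h + e1 i - 1)
    (by linarith [f11 i]) (by intro h; linarith [hC i (by linarith)])
  have Epos : ∀ᶠ δ in nhdsWithin (0 : ℝ) (Set.Ioi 0), (0 : ℝ) < δ := self_mem_nhdsWithin
  obtain ⟨δ, hδ, g0, g3, g4, g7, g8, g9, g10, g11⟩ :=
    (Epos.and (E0.and (E3.and (E4.and (E7.and (E8.and (E9.and (E10.and E11)))))))).exists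
  have hcolsum : ∀ h, ∑ i, (y i h - δ * d i h) = ∑ i, y i h - δ := by
    intro h; rw [Finset.sum_sub_distrib, ← Finset.mul_sum, hdc, mul_one]
  have hgrp : ∀ (G : Finset M) i, ∑ h ∈ G, ((b i h : ℝ) - (y i h - δ * d i h)) =
      ∑ h ∈ G, ((b i h : ℝ) - y i h) + δ * ∑ h ∈ G, d i h := by
    intro G i
    rw [Finset.mul_sum, ← Finset.sum_add_distrib]
    exact Finset.sum_congr rfl fun h _ => by ring
  refine ⟨δ, hδ, by linarith, ?_, ?_, ?_, ?_, ?_, ?_, ?_, ?_, ?_, ?_, ?_⟩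
  · intro h hh
    obtain ⟨p, q⟩ := hsat1 h hh
    rw [hcolsum]; constructor <;> linarith
  · intro h hh
    obtain ⟨p, q⟩ := hsat2 h hh
    rw [hcolsum]; constructor <;> linarith
  · intro i
    rw [Finset.sum_sub_distrib, ← Finset.mul_sum]
    linarith [g3 i]
  · intro i h
    have := mul_nonneg hδ.le (hd0 i h)
    constructor
    · linarith [g4 i h]
    · linarith [(f4 i h).2]
  · rw [Finset.sum_sub_distrib, ← Finset.mul_sum, hs1, f5, mul_one]
  · rw [Finset.sum_sub_distrib, ← Finset.mul_sum, hs2, f6, mul_one]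
  · intro i; linarith [g7 i]
  · intro i
    have := mul_nonneg hδ.le (he1 i)
    constructor
    · linarith [g8 i]
    · linarith [(f8 i).2]
  · intro i
    have := mul_nonneg hδ.le (he2 i)
    constructor
    · linarith [g9 i]
    · linarith [(f9 i).2]
  · intro i
    rw [hgrp]; linarith [g10 i]
  · intro i
    rw [hgrp]; linarith [g11 i]

theorem epsR_pos
    {J M : Type*} [Fintype J] [Fintype M] [DecidableEq J] [DecidableEq M]
    (G1 G2 : Finset M) (hG1ne : G1.Nonempty) (hG2ne : G2.Nonempty)
    (hdisj : Disjoint G1 G2) (hcover : G1 ∪ G2 = Finset.univ)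
    (b : J → M → ℕ) (a1 a2 : J → ℕ)
    (ystar : J → M → ℝ) (x1star x2star : J → ℝ) (rstar wstar : ℝ)
    (hstar : FeasibleS G1 G2 b a1 a2 ystar x1star x2star rstar wstar)
    (hstaropt : ∀ y' x1' x2' r' w', FeasibleS G1 G2 b a1 a2 y' x1' x2' r' w' →
      wstar - rstar ≤ w' - r')
    (y : J → M → ℝ) (x1 x2 : J → ℝ) (r w : ℝ)
    (hfeas : FeasibleLP G1 G2 b a1 a2 rstar wstar y x1 x2 r w)
    (hopt : ∀ y' x1' x2' r' w',
      FeasibleLP G1 G2 b a1 a2 rstar wstar y' x1' x2' r' w' → r ≤ r')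
    (ε : ℝ) (hε0 : 0 < ε) (hε1 : ε < 1) (hrε : r = (⌊rstar⌋ : ℝ) + ε)
    (hsat1 : ∀ h ∈ G1, ((∑ j, y j h) = w) ∧
      (w = (∑ j, (b j h : ℝ)) - ((∑ j, (a2 j : ℝ)) - r)))
    (hsat2 : ∀ h ∈ G2, ((∑ j, y j h) = w) ∧
      (w = (∑ j, (b j h : ℝ)) - ((∑ j, (a1 j : ℝ)) - r)))
    (B1 B2 : Finset J)
    (hB1 : ∀ j, j ∈ B1 ↔ ¬∃ z : ℤ, x1 j = (z : ℝ))
    (hB2 : ∀ j, j ∈ B2 ↔ ¬∃ z : ℤ, x2 j = (z : ℝ))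
    :
    ∀ g ∈ B1, ∀ k ∈ B2, 0 < epsR B1 B2 x1 x2 r ε g k := by
  intro g hg k hk
  obtain ⟨hS, hwr, hfl⟩ := hfeas
  have hS' := hS
  obtain ⟨-, -, f3, f4, f5, f6, f7, f8, f9, f10, f11⟩ := hS'
  have hgn := (hB1 g).1 hg
  have hkn := (hB2 k).1 hk
  have hxg : 0 < x1 g := lt_of_le_of_ne (f8 g).1 fun h => hgn ⟨0, by simp [← h]⟩
  have hxk : 0 < x2 k := lt_of_le_of_ne (f9 k).1 fun h => hkn ⟨0, by simp [← h]⟩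
  have hrni : ∀ z : ℤ, r ≠ z := by
    intro z hz
    rw [hrε] at hz
    have h1 : ε = ((z - ⌊rstar⌋ : ℤ) : ℝ) := by push_cast; linarith
    rw [h1] at hε0 hε1
    have h2 : (0 : ℤ) < z - ⌊rstar⌋ := by exact_mod_cast hε0
    have h3 : z - ⌊rstar⌋ < (1 : ℤ) := by exact_mod_cast hε1
    omega
  have hw0 : 0 < w := by
    have h1 : 0 ≤ w := (Finset.sum_nonneg fun h _ => (f4 g h).1).trans (f3 g)
    refine lt_of_le_of_ne h1 fun h => hrni (-⌈wstar - rstar⌉) ?_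
    push_cast; linarith
  -- the main claim
  have key : ∀ j, j ≠ g → j ≠ k → x1 j + x2 j < r := by
    intro j hjg hjk
    by_contra hcon
    have htight : x1 j + x2 j = r := le_antisymm (f7 j) (not_lt.1 hcon)
    have hpair : ∀ (x : J → ℝ), (∀ i, 0 ≤ x i) → ∀ i i', i ≠ i' → x i + x i' ≤ ∑ l, x l := by
      intro x hx i i' hii
      rw [← Finset.sum_pair hii]
      exact Finset.sum_le_sum_of_subset_of_nonneg (Finset.subset_univ _) fun l _ _ => hx l
    have hxj1 : 0 < x1 j := by linarith [hpair x2 (fun i => (f9 i).1) j k hjk]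
    have hxj2 : 0 < x2 j := by linarith [hpair x1 (fun i => (f8 i).1) j g hjg]
    have hothers : ∀ i, i ≠ j → x1 i + x2 i = r → i = k ∧ i = g := by
      intro i hij hi
      have hp1 := hpair x1 (fun i => (f8 i).1) i j hij
      have hp2 := hpair x2 (fun i => (f9 i).1) i j hij
      have htri : ∀ (x : J → ℝ), (∀ i, 0 ≤ x i) → ∀ l, l ≠ i → l ≠ j →
          x l + (x i + x j) ≤ ∑ l, x l := by
        intro x hx l hli hlj
        rw [← Finset.sum_pair hij, ← Finset.sum_insert (by simp [hli, hlj])]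
        exact Finset.sum_le_sum_of_subset_of_nonneg (Finset.subset_univ _) fun l _ _ => hx l
      constructor
      · by_contra hne
        linarith [htri x2 (fun i => (f9 i).1) k (Ne.symm hne) (Ne.symm hjk)]
      · by_contra hne
        linarith [htri x1 (fun i => (f8 i).1) g (Ne.symm hne) (Ne.symm hjg)]
    -- no step is possible
    have nostep : ∀ (d : J → M → ℝ) (θ : ℝ), 0 ≤ θ → θ ≤ 1 → (∀ i h, 0 ≤ d i h) →
        (∀ i h, y i h = 0 → d i h = 0) → (∀ h, ∑ i, d i h = 1) → (∀ i, ∑ h, d i h ≤ 1) →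
        (∀ i, ∑ h, y i h = w → ∑ h, d i h = 1) →
        ∑ h ∈ G1, d j h ≤ θ → ∑ h ∈ G2, d j h ≤ 1 - θ →
        ((∑ h ∈ G1, ((b k h : ℝ) - y k h)) + (a2 k : ℝ) - x2 k = (∑ j', (a2 j' : ℝ)) - r →
          ∑ h ∈ G1, d k h ≤ 1 - θ) →
        ((∑ h ∈ G2, ((b g h : ℝ) - y g h)) + (a1 g : ℝ) - x1 g = (∑ j', (a1 j' : ℝ)) - r →
          ∑ h ∈ G2, d g h ≤ θ) → False := by
      intro d θ hθ0 hθ1 hd0 hdy hdc hdr1 hdr hj1 hj2 hkA hgC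
      have hsub : ∀ (G : Finset M) i, ∑ h ∈ G, d i h ≤ 1 := fun G i =>
        (Finset.sum_le_sum_of_subset_of_nonneg (Finset.subset_univ _)
          fun h _ _ => hd0 i h).trans (hdr1 i)
      obtain ⟨δ, hδ, hδf, hδS⟩ := exists_step G1 G2 b a1 a2 y x1 x2 r w (⌊rstar⌋ : ℝ) hS
        (by linarith) hsat1 hsat2 d
        (fun i => (if i = j then θ else 0) + (if i = g then 1 - θ else 0))
        (fun i => (if i = j then 1 - θ else 0) + (if i = k then θ else 0))
        hd0 hdy hdc hdr
        (by intro i; split_ifs <;> linarith)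
        (by intro i; split_ifs <;> linarith)
        (by
          intro i hi
          have h1 : i ≠ j := by rintro rfl; linarith
          have h2 : i ≠ g := by rintro rfl; linarith
          simp [h1, h2])
        (by
          intro i hi
          have h1 : i ≠ j := by rintro rfl; linarith
          have h2 : i ≠ k := by rintro rfl; linarith
          simp [h1, h2])
        (by simp [Finset.sum_add_distrib])
        (by simp [Finset.sum_add_distrib])
        (by
          intro i hi
          by_cases hij : i = j
          · subst hij; simp [hjg, hjk]
          · obtain ⟨h1, h2⟩ := hothers i hij hi
            simp only [if_neg hij, if_pos h1, if_pos h2]; linarith)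
        (by
          intro i hi
          by_cases hij : i = j
          · subst hij; simp only [if_true, if_neg hjk]; linarith
          · by_cases hik : i = k
            · subst hik; simp only [if_neg hij, if_true]; linarith [hkA hi]
            · simp only [if_neg hij, if_neg hik]; linarith [hsub G1 i])
        (by
          intro i hi
          by_cases hij : i = j
          · subst hij; simp only [if_true, if_neg hjg]; linarith
          · by_cases hig : i = g
            · subst hig; simp only [if_neg hij, if_true]; linarith [hgC hi]
            · simp only [if_neg hij, if_neg hig]; linarith [hsub G2 i])
      have := hopt _ _ _ _ _ ⟨hδS, by linarith, hδf⟩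
      linarith
    -- matchings
    have hcolw : ∀ h, ∑ i, y i h = w := by
      intro h
      have : h ∈ G1 ∪ G2 := by rw [hcover]; exact Finset.mem_univ h
      rcases Finset.mem_union.1 this with h1 | h1
      · exact (hsat1 h h1).1
      · exact (hsat2 h h1).1
    have hmatch : ∀ l (G : Finset M), ∑ h ∈ G, y l h < w →
        ∃ d : J → M → ℝ, (∀ i h, 0 ≤ d i h) ∧ (∀ i h, y i h = 0 → d i h = 0) ∧
          (∀ h, ∑ i, d i h = 1) ∧ (∀ i, ∑ h, d i h ≤ 1) ∧
          (∀ i, ∑ h, y i h = w → ∑ h, d i h = 1) ∧ (∀ h ∈ G, d l h = 0) ∧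
          (∀ (H : Finset M) i, (∀ h ∈ H, d i h = 0) ∨ (∀ h, h ∉ H → d i h = 0)) := by
      intro l G hl
      obtain ⟨d, q1, q2, q3, q4, q5, q6, q7⟩ := exists_matching (fun i h => y i h / w)
        (fun i h => div_nonneg (f4 i h).1 hw0.le)
        (fun h => by rw [← Finset.sum_div, hcolw, div_self hw0.ne'])
        (fun i => by rw [← Finset.sum_div, div_le_one hw0]; exact f3 i)
        l G (by rw [← Finset.sum_div, div_lt_one hw0]; exact hl)
      refine ⟨d, q1, fun i h h0 => q2 i h (by simp [h0]), q3, q4, fun i hi => q5 i ?_, q6, q7⟩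
      rw [← Finset.sum_div, hi, div_self hw0.ne']
    have hle : ∀ i (G : Finset M), ∑ h ∈ G, y i h ≤ w := fun i G =>
      (Finset.sum_le_sum_of_subset_of_nonneg (Finset.subset_univ _)
        fun h _ _ => (f4 i h).1).trans (f3 i)
    have hM1 : ∃ d : J → M → ℝ, (∀ i h, 0 ≤ d i h) ∧ (∀ i h, y i h = 0 → d i h = 0) ∧
          (∀ h, ∑ i, d i h = 1) ∧ (∀ i, ∑ h, d i h ≤ 1) ∧
          (∀ i, ∑ h, y i h = w → ∑ h, d i h = 1) ∧
          ((∑ h ∈ G1, ((b k h : ℝ) - y k h)) + (a2 k : ℝ) - x2 k = (∑ j', (a2 j' : ℝ)) - r →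
            ∑ h ∈ G1, d k h = 0) ∧
          (∀ (H : Finset M) i, (∀ h ∈ H, d i h = 0) ∨ (∀ h, h ∉ H → d i h = 0)) := by
      by_cases ht : (∑ h ∈ G1, ((b k h : ℝ) - y k h)) + (a2 k : ℝ) - x2 k =
          (∑ j', (a2 j' : ℝ)) - r
      · obtain ⟨d, q1, q2, q3, q4, q5, q6, q7⟩ := hmatch k G1 (by
          refine lt_of_le_of_ne (hle k G1) fun heq => hkn
            ⟨(∑ h ∈ G1, (b k h : ℤ)) + a2 k - (∑ j', (a2 j' : ℤ)) - ⌈wstar - rstar⌉, ?_⟩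
          rw [Finset.sum_sub_distrib, heq] at ht
          push_cast
          linarith)
        exact ⟨d, q1, q2, q3, q4, q5, fun _ => Finset.sum_eq_zero q6, q7⟩
      · obtain ⟨d, q1, q2, q3, q4, q5, q6, q7⟩ := hmatch k ∅ (by simpa using hw0)
        exact ⟨d, q1, q2, q3, q4, q5, fun h => absurd h ht, q7⟩
    have hM2 : ∃ d : J → M → ℝ, (∀ i h, 0 ≤ d i h) ∧ (∀ i h, y i h = 0 → d i h = 0) ∧
          (∀ h, ∑ i, d i h = 1) ∧ (∀ i, ∑ h, d i h ≤ 1) ∧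
          (∀ i, ∑ h, y i h = w → ∑ h, d i h = 1) ∧
          ((∑ h ∈ G2, ((b g h : ℝ) - y g h)) + (a1 g : ℝ) - x1 g = (∑ j', (a1 j' : ℝ)) - r →
            ∑ h ∈ G2, d g h = 0) ∧
          (∀ (H : Finset M) i, (∀ h ∈ H, d i h = 0) ∨ (∀ h, h ∉ H → d i h = 0)) := by
      by_cases ht : (∑ h ∈ G2, ((b g h : ℝ) - y g h)) + (a1 g : ℝ) - x1 g =
          (∑ j', (a1 j' : ℝ)) - r
      · obtain ⟨d, q1, q2, q3, q4, q5, q6, q7⟩ := hmatch g G2 (by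
          refine lt_of_le_of_ne (hle g G2) fun heq => hgn
            ⟨(∑ h ∈ G2, (b g h : ℤ)) + a1 g - (∑ j', (a1 j' : ℤ)) - ⌈wstar - rstar⌉, ?_⟩
          rw [Finset.sum_sub_distrib, heq] at ht
          push_cast
          linarith)
        exact ⟨d, q1, q2, q3, q4, q5, fun _ => Finset.sum_eq_zero q6, q7⟩
      · obtain ⟨d, q1, q2, q3, q4, q5, q6, q7⟩ := hmatch g ∅ (by simpa using hw0)
        exact ⟨d, q1, q2, q3, q4, q5, fun h => absurd h ht, q7⟩
    obtain ⟨d, p1, p2, p3, p4, p5, p6, p7⟩ := hM1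
    obtain ⟨d', q1, q2, q3, q4, q5, q6, q7⟩ := hM2
    have dsub : ∀ (G : Finset M) i, ∑ h ∈ G, d i h ≤ 1 := fun G i =>
      (Finset.sum_le_sum_of_subset_of_nonneg (Finset.subset_univ _)
        fun h _ _ => p1 i h).trans (p4 i)
    have dsub' : ∀ (G : Finset M) i, ∑ h ∈ G, d' i h ≤ 1 := fun G i =>
      (Finset.sum_le_sum_of_subset_of_nonneg (Finset.subset_univ _)
        fun h _ _ => q1 i h).trans (q4 i)
    rcases p7 G2 j with c | c
    · exact nostep d 1 zero_le_one le_rfl p1 p2 p3 p4 p5 (dsub _ _)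
        (by rw [Finset.sum_eq_zero c]; norm_num) (fun h => by rw [p6 h]; norm_num)
        (fun _ => dsub _ _)
    have c1 : ∑ h ∈ G1, d j h = 0 :=
      Finset.sum_eq_zero fun h hh => c h (Finset.disjoint_left.1 hdisj hh)
    rcases q7 G1 j with c' | c'
    · exact nostep d' 0 le_rfl zero_le_one q1 q2 q3 q4 q5
        (by rw [Finset.sum_eq_zero c']) (by simpa using dsub' _ _)
        (fun _ => by simpa using dsub' _ _) (fun h => by rw [q6 h])
    have c2 : ∑ h ∈ G2, d' j h = 0 :=
      Finset.sum_eq_zero fun h hh => c' h (Finset.disjoint_right.1 hdisj hh)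
    have havg : ∀ (G : Finset M) i, ∑ h ∈ G, (d i h + d' i h) / 2 =
        (∑ h ∈ G, d i h + ∑ h ∈ G, d' i h) / 2 := by
      intro G i; rw [← Finset.sum_div, Finset.sum_add_distrib]
    refine nostep (fun i h => (d i h + d' i h) / 2) (1 / 2) (by norm_num) (by norm_num)
      (fun i h => by linarith [p1 i h, q1 i h])
      (fun i h h0 => by simp [p2 i h h0, q2 i h h0])
      (fun h => by rw [← Finset.sum_div, Finset.sum_add_distrib, p3, q3]; norm_num)
      (fun i => by rw [havg]; linarith [p4 i, q4 i])
      (fun i hi => by rw [havg, p5 i hi, q5 i hi]; norm_num)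
      (by rw [havg, c1]; linarith [dsub' G1 j])
      (by rw [havg, c2]; linarith [dsub G2 j])
      (fun h => by rw [havg, p6 h]; linarith [dsub' G1 k])
      (fun h => by rw [havg, q6 h]; linarith [dsub G2 g])
  unfold epsR
  split_ifs with hne
  · refine lt_min ?_ hε0
    rw [Finset.lt_inf'_iff]
    intro j hj
    simp only [Finset.mem_sdiff, Finset.mem_insert, Finset.mem_singleton, not_or] at hj
    linarith [key j hj.2.1 hj.2.2]
  · exact hε0
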